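/- arXiv:2409.04423 — 6 statements merged into one kernel-verified Lean document; each statement's English description precedes it below -/
import Mathlib

section
/- Let a, k, m, c, d be positive integers and b an integer with k > m > k − c. Then the limit as n → ∞ (over positive integers n large enough that n^k − a·n^m + b·n^(k−c) ≥ d·n^(k−m)) of the ratio of binomial coefficients C(n^k − a·n^m + b·n^(k−c), d·n^(k−m)) / C(n^k, d·n^(k−m)) equals e^(−d·a). -/
open Filter

theorem Nat.descFactorial_mul_pow_le {M N : ℕ} (h : M ≤ N) (r : ℕ) :
    M.descFactorial r * N ^ r ≤ M ^ r * N.descFactorial r := by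
  induction r with
  | zero => simp
  | succ r ih =>
    have key : (M - r) * N ≤ M * (N - r) := by
      rw [Nat.sub_mul, Nat.mul_sub]
      have : M * r ≤ r * N := by rw [mul_comm]; gcongr
      omega
    calc M.descFactorial (r + 1) * N ^ (r + 1)
        = ((M - r) * N) * (M.descFactorial r * N ^ r) := by
          rw [Nat.descFactorial_succ]; ring
      _ ≤ (M * (N - r)) * (M ^ r * N.descFactorial r) := Nat.mul_le_mul key ih
      _ = _ := by rw [Nat.descFactorial_succ]; ring

theorem Nat.sub_pow_mul_descFactorial_le {M N s : ℕ} (h : M ≤ N) (hs : s ≤ M) {r : ℕ}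
    (hr : r ≤ s) :
    (M - s) ^ r * N.descFactorial r ≤ M.descFactorial r * (N - s) ^ r := by
  induction r with
  | zero => simp
  | succ r ih =>
    have key : (M - s) * (N - r) ≤ (M - r) * (N - s) := by
      obtain ⟨u, rfl⟩ := Nat.exists_eq_add_of_le hs
      obtain ⟨v, rfl⟩ := Nat.exists_eq_add_of_le h
      obtain ⟨w, rfl⟩ := Nat.exists_eq_add_of_le (Nat.le_of_succ_le hr)
      have h1 : r + w + u - (r + w) = u := by omega
      have h2 : r + w + u + v - r = w + u + v := by omega
      have h3 : r + w + u - r = w + u := by omega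
      have h4 : r + w + u + v - (r + w) = u + v := by omega
      rw [h1, h2, h3, h4]
      nlinarith [Nat.zero_le (w * v)]
    calc (M - s) ^ (r + 1) * N.descFactorial (r + 1)
        = ((M - s) * (N - r)) * ((M - s) ^ r * N.descFactorial r) := by
          rw [Nat.descFactorial_succ]; ring
      _ ≤ ((M - r) * (N - s)) * (M.descFactorial r * (N - s) ^ r) :=
          Nat.mul_le_mul key (ih (Nat.le_of_succ_le hr))
      _ = _ := by rw [Nat.descFactorial_succ]; ring

theorem Nat.choose_div_choose_eq_descFactorial_div (M N r : ℕ) :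
    (M.choose r : ℝ) / N.choose r = (M.descFactorial r : ℝ) / N.descFactorial r := by
  rw [Nat.descFactorial_eq_factorial_mul_choose, Nat.descFactorial_eq_factorial_mul_choose]
  push_cast
  rw [mul_div_mul_left _ _ (by exact_mod_cast r.factorial_ne_zero)]

theorem Nat.choose_div_choose_le_pow {M N r : ℕ} (h : M ≤ N) (hr : r < N) :
    (M.choose r : ℝ) / N.choose r ≤ (1 + ((M : ℝ) - N) / N) ^ r := by
  have hN : (0 : ℝ) < N := by exact_mod_cast (Nat.zero_le r).trans_lt hr
  have hD : (0 : ℝ) < N.descFactorial r := by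
    exact_mod_cast Nat.descFactorial_pos.2 hr.le
  have e : 1 + ((M : ℝ) - N) / N = M / N := by field_simp; ring
  rw [Nat.choose_div_choose_eq_descFactorial_div, e, div_pow, div_le_div_iff₀ hD (by positivity)]
  exact_mod_cast Nat.descFactorial_mul_pow_le h r

theorem Nat.pow_le_choose_div_choose {M N r : ℕ} (h : M ≤ N) (hr : r ≤ M) (hrN : r < N) :
    (1 + ((M : ℝ) - N) / (N - r)) ^ r ≤ (M.choose r : ℝ) / N.choose r := by
  have hN : (0 : ℝ) < N - r := by
    rw [sub_pos]; exact_mod_cast hrN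
  have hD : (0 : ℝ) < N.descFactorial r := by
    exact_mod_cast Nat.descFactorial_pos.2 hrN.le
  have e : 1 + ((M : ℝ) - N) / (N - r) = (M - r) / (N - r) := by
    rw [eq_div_iff hN.ne', add_mul, div_mul_cancel₀ _ hN.ne']; ring
  rw [Nat.choose_div_choose_eq_descFactorial_div, e, div_pow, div_le_div_iff₀ (by positivity) hD,
    ← Nat.cast_sub hr, ← Nat.cast_sub hrN.le]
  exact_mod_cast Nat.sub_pow_mul_descFactorial_le h hr le_rfl

/-- If `r → ∞` and `r g → L` along any filter, then `(1 + g) ^ r → exp L`. -/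
theorem Real.tendsto_one_add_pow_exp_of_tendsto_mul {α : Type*} {l : Filter α} {r : α → ℕ}
    {g : α → ℝ} {L : ℝ} (hr : Tendsto r l atTop)
    (hg : Tendsto (fun n => (r n : ℝ) * g n) l (nhds L)) :
    Tendsto (fun n => (1 + g n) ^ r n) l (nhds (Real.exp L)) := by
  have hr' : Tendsto (fun n => (r n : ℝ)) l atTop := tendsto_natCast_atTop_atTop.comp hr
  have hg0 : Tendsto g l (nhds 0) := by
    refine (hg.div_atTop hr').congr' ?_
    filter_upwards [hr'.eventually_gt_atTop 0] with n hn
    rw [mul_div_cancel_left₀ _ hn.ne']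
  have hder : HasDerivAt (fun x : ℝ => Real.log (1 + x)) 1 0 := by
    simpa using ((hasDerivAt_id (0 : ℝ)).const_add 1).log (by simp)
  have hslope : Tendsto (fun n => dslope (fun x : ℝ => Real.log (1 + x)) 0 (g n)) l (nhds 1) := by
    have hc := (continuousAt_dslope_same.2 hder.differentiableAt).tendsto
    rw [dslope_same, hder.deriv] at hc
    exact hc.comp hg0
  have hlog := hg.mul hslope
  rw [mul_one] at hlog
  refine ((Real.continuous_exp.tendsto L).comp hlog).congr' ?_
  filter_upwards [hg0.eventually_const_lt (show (-1 : ℝ) < 0 by norm_num)] with n hn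
  have h := sub_smul_dslope (fun x : ℝ => Real.log (1 + x)) 0 (g n)
  simp only [sub_zero, smul_eq_mul, add_zero, Real.log_one] at h
  rw [Function.comp_apply, mul_assoc, h, Real.exp_nat_mul, Real.exp_log (by linarith)]

/-- If `r → ∞`, `r = o(N)` and `r (M - N) / N → L`, then `C(M, r) / C(N, r) → exp L`. -/
theorem Nat.tendsto_choose_div_choose_exp {M N r : ℕ → ℕ} {L : ℝ}
    (hMN : ∀ᶠ n in atTop, M n ≤ N n) (hrM : ∀ᶠ n in atTop, r n ≤ M n)
    (hrN : ∀ᶠ n in atTop, r n < N n) (hr : Tendsto r atTop atTop)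
    (hr0 : Tendsto (fun n => (r n : ℝ) / N n) atTop (nhds 0))
    (hL : Tendsto (fun n => (r n : ℝ) * (((M n : ℝ) - N n) / N n)) atTop (nhds L)) :
    Tendsto (fun n => ((M n).choose (r n) : ℝ) / (N n).choose (r n)) atTop
      (nhds (Real.exp L)) := by
  have hL' : Tendsto (fun n => (r n : ℝ) * (((M n : ℝ) - N n) / (N n - r n))) atTop
      (nhds L) := by
    have := hL.div (tendsto_const_nhds (x := (1 : ℝ)).sub hr0) (by norm_num)
    rw [sub_zero, div_one] at this
    refine this.congr' ?_
    filter_upwards [hrN] with n hn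
    have h1 : (0 : ℝ) < N n := by exact_mod_cast (Nat.zero_le _).trans_lt hn
    have h2 : (0 : ℝ) < N n - r n := by rw [sub_pos]; exact_mod_cast hn
    simp only [Pi.div_apply]
    field_simp
  refine tendsto_of_tendsto_of_tendsto_of_le_of_le'
    (Real.tendsto_one_add_pow_exp_of_tendsto_mul hr hL')
    (Real.tendsto_one_add_pow_exp_of_tendsto_mul hr hL) ?_ ?_
  · filter_upwards [hMN, hrM, hrN] with n h1 h2 h3 using Nat.pow_le_choose_div_choose h1 h2 h3
  · filter_upwards [hMN, hrN] with n h1 h3 using Nat.choose_div_choose_le_pow h1 h3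

/-- For positive integers `a, k, m, c, d` and any integer `b` with `k > m > k - c`,
the ratio `C(n^k - a·n^m + b·n^(k-c), d·n^(k-m)) / C(n^k, d·n^(k-m))` tends to `e^(-d·a)`
as `n → ∞`. -/
theorem stmt0 (a k m c d : ℕ) (b : ℤ)
    (ha : 0 < a) (hk : 0 < k) (hm : 0 < m) (hc : 0 < c) (hd : 0 < d)
    (hmk : m < k) (hkc : k - c < m) :
    Tendsto (fun n : ℕ =>
      (((((n : ℤ) ^ k - a * (n : ℤ) ^ m + b * (n : ℤ) ^ (k - c)).toNat).choose
          (d * n ^ (k - m)) : ℝ)) /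
        (((n ^ k).choose (d * n ^ (k - m)) : ℝ)))
      atTop (nhds (Real.exp (-((d : ℝ) * a)))) := by
  have hpow : ∀ {p q : ℕ}, p < q →
      Tendsto (fun n : ℕ => (n : ℝ) ^ p / (n : ℝ) ^ q) atTop (nhds 0) := fun h =>
    (tendsto_pow_div_pow_atTop_zero h).comp tendsto_natCast_atTop_atTop
  have hE : Tendsto (fun n : ℕ => -(a : ℝ) + b * ((n : ℝ) ^ (k - c) / (n : ℝ) ^ m)) atTop
      (nhds (-(a : ℝ))) := by
    simpa using ((hpow hkc).const_mul (b : ℝ)).const_add (-(a : ℝ))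
  have hR : Tendsto (fun n : ℕ => (d : ℝ) * ((n : ℝ) ^ (k - m) / (n : ℝ) ^ k)) atTop
      (nhds 0) := by
    simpa using (hpow (show k - m < k by omega)).const_mul (d : ℝ)
  -- `(M - r) / N → 1`, where `M`, `r`, `N` are the three arguments of the binomials
  have hQ : Tendsto (fun n : ℕ => 1 + ((n : ℝ) ^ m / (n : ℝ) ^ k) *
      (-(a : ℝ) + b * ((n : ℝ) ^ (k - c) / (n : ℝ) ^ m)) -
      (d : ℝ) * ((n : ℝ) ^ (k - m) / (n : ℝ) ^ k)) atTop (nhds 1) := by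
    simpa using (((hpow hmk).mul hE).const_add 1).sub hR
  have hrM : ∀ᶠ n : ℕ in atTop, ((d * n ^ (k - m) : ℕ) : ℤ) ≤
      (n : ℤ) ^ k - a * (n : ℤ) ^ m + b * (n : ℤ) ^ (k - c) := by
    filter_upwards [hQ.eventually_const_lt one_pos, eventually_gt_atTop 0] with n hn hn0
    have h0 : (0 : ℝ) < n := by exact_mod_cast hn0
    have h1 := mul_pos hn (pow_pos h0 k)
    have h2 : ((d * n ^ (k - m) : ℕ) : ℝ) ≤
      (n : ℝ) ^ k - a * (n : ℝ) ^ m + b * (n : ℝ) ^ (k - c) := by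
      push_cast
      field_simp at h1
      linarith
    exact_mod_cast h2
  have hMN : ∀ᶠ n : ℕ in atTop,
      (n : ℤ) ^ k - a * (n : ℤ) ^ m + b * (n : ℤ) ^ (k - c) ≤ (n : ℤ) ^ k := by
    have ha' : -(a : ℝ) < 0 := by simpa using ha
    filter_upwards [hE.eventually_lt_const ha', eventually_gt_atTop 0] with n hn hn0
    have h0 : (0 : ℝ) < n := by exact_mod_cast hn0
    have h1 := mul_neg_of_neg_of_pos hn (pow_pos h0 m)
    have h2 : (n : ℝ) ^ k - a * (n : ℝ) ^ m + b * (n : ℝ) ^ (k - c) ≤ (n : ℝ) ^ k := by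
      rw [add_mul, mul_assoc, div_mul_cancel₀ _ (pow_pos h0 m).ne'] at h1
      linarith
    exact_mod_cast h2
  have main := Nat.tendsto_choose_div_choose_exp (L := -((d : ℝ) * a))
    (M := fun n : ℕ => ((n : ℤ) ^ k - a * (n : ℤ) ^ m + b * (n : ℤ) ^ (k - c)).toNat)
    (N := fun n => n ^ k) (r := fun n => d * n ^ (k - m)) ?_ ?_ ?_ ?_ ?_ ?_
  · exact main
  · filter_upwards [hMN] with n hn
    rw [Int.toNat_le]
    exact_mod_cast hn
  · filter_upwards [hrM] with n hn
    exact (Int.le_toNat ((Int.natCast_nonneg _).trans hn)).2 hn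
  · filter_upwards [hR.eventually_lt_const one_pos, eventually_gt_atTop 0] with n hn hn0
    have h0 : (0 : ℝ) < n := by exact_mod_cast hn0
    rw [← mul_div_assoc, div_lt_one (by positivity)] at hn
    exact_mod_cast hn
  · exact (tendsto_pow_atTop (by omega)).const_mul_atTop' hd
  · simpa [mul_div_assoc] using hR
  · have hdE := hE.const_mul (d : ℝ)
    rw [mul_neg] at hdE
    refine hdE.congr' ?_
    filter_upwards [hrM, eventually_gt_atTop 0] with n hn hn0
    have h0 : (0 : ℝ) < n := by exact_mod_cast hn0
    have hc : (((((n : ℤ) ^ k - a * (n : ℤ) ^ m + b * (n : ℤ) ^ (k - c)).toNat : ℕ) : ℤ) : ℝ) =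
        (n : ℝ) ^ k - a * (n : ℝ) ^ m + b * (n : ℝ) ^ (k - c) := by
      rw [Int.toNat_of_nonneg ((Int.natCast_nonneg _).trans hn)]
      push_cast
      rfl
    rw [Int.cast_natCast] at hc
    have hp : (n : ℝ) ^ k = (n : ℝ) ^ (k - m) * (n : ℝ) ^ m := by
      rw [← pow_add]; congr 1; omega
    rw [hc]
    push_cast
    rw [hp]
    field_simp
    ring
end

section
/- The limit as n → ∞ of the real expression ((1 − n/(n² − 2n))^(−2) · ((n−1)/2 · (1 − n/(n² − 2n))^(−n−1) − (n+1)/2 · (1 − n/(n² − 2n))^(−n+1) + 1)) / (n² · (1 − (1 − n/(n² − 2n))^(−2))²) equals 1/4. -/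
open Filter

/-- With `n = m + 3` the base `1 - n/(n² - 2n)` is the inverse of `1 + 1/m`. -/
theorem one_sub_div_sq_sub_eq_inv {m : ℕ} (hm : 0 < m) :
    1 - ((m + 3 : ℕ) : ℝ) / (((m + 3 : ℕ) : ℝ) ^ 2 - 2 * ((m + 3 : ℕ) : ℝ)) =
      (1 + 1 / (m : ℝ))⁻¹ := by
  have hm' : (0 : ℝ) < m := by exact_mod_cast hm
  have h : (((m + 3 : ℕ) : ℝ) ^ 2 - 2 * ((m + 3 : ℕ) : ℝ)) = ((m : ℝ) + 3) * (m + 1) := by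
    push_cast
    ring
  rw [h]
  push_cast
  field_simp
  ring

/-- The limit as `n → ∞` of
`((1 - n/(n² - 2n))^(-2) · ((n-1)/2 · (1 - n/(n² - 2n))^(-n-1)
    - (n+1)/2 · (1 - n/(n² - 2n))^(-n+1) + 1)) /
  (n² · (1 - (1 - n/(n² - 2n))^(-2))²)` equals `1/4`. -/
theorem stmt13 :
    Tendsto (fun n : ℕ =>
      ((1 - (n : ℝ) / ((n : ℝ) ^ 2 - 2 * n)) ^ (-2 : ℤ) *
          (((n : ℝ) - 1) / 2 * (1 - (n : ℝ) / ((n : ℝ) ^ 2 - 2 * n)) ^ (-(n : ℤ) - 1) -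
            ((n : ℝ) + 1) / 2 * (1 - (n : ℝ) / ((n : ℝ) ^ 2 - 2 * n)) ^ (-(n : ℤ) + 1) + 1)) /
        ((n : ℝ) ^ 2 * (1 - (1 - (n : ℝ) / ((n : ℝ) ^ 2 - 2 * n)) ^ (-2 : ℤ)) ^ 2))
      atTop (nhds (1 / 4)) := by
  rw [← tendsto_add_atTop_iff_nat 3]
  have ht : Tendsto (fun m : ℕ => 1 / (m : ℝ)) atTop (nhds 0) :=
    tendsto_one_div_atTop_nhds_zero_nat
  have hE : Tendsto (fun m : ℕ => (1 + 1 / (m : ℝ)) ^ m) atTop (nhds (Real.exp 1)) :=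
    Real.tendsto_one_add_div_pow_exp 1
  have hlim : Tendsto (fun m : ℕ => (1 + 1 / (m : ℝ)) ^ 2 *
      ((1 + 1 / (m : ℝ)) ^ m * (1 + 1 / (m : ℝ)) ^ 2 *
        ((5 * (1 / (m : ℝ)) + 2 * (1 / (m : ℝ)) ^ 2) / 2) + 1) /
      ((1 + 3 * (1 / (m : ℝ))) * (2 + 1 / (m : ℝ))) ^ 2) atTop
      (nhds ((1 + 0) ^ 2 * (Real.exp 1 * (1 + 0) ^ 2 * ((5 * 0 + 2 * 0 ^ 2) / 2) + 1) /
        ((1 + 3 * 0) * (2 + 0)) ^ 2)) := by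
    have h1 := (ht.const_add 1).pow 2
    have h2 := ((ht.const_mul 5).add ((ht.pow 2).const_mul 2)).div_const 2
    have h3 := (((ht.const_mul 3).const_add 1).mul (ht.const_add 2)).pow 2
    exact (h1.mul (((hE.mul h1).mul h2).add_const 1)).div h3 (by norm_num)
  have hval : ((1 + 0) ^ 2 * (Real.exp 1 * (1 + 0) ^ 2 * ((5 * 0 + 2 * 0 ^ 2) / 2) + 1) /
      ((1 + 3 * 0) * (2 + 0)) ^ 2 : ℝ) = 1 / 4 := by
    norm_num
  rw [hval] at hlim
  refine hlim.congr' ?_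
  filter_upwards [eventually_gt_atTop 0] with m hm
  have hm' : (0 : ℝ) < m := by exact_mod_cast hm
  rw [one_sub_div_sq_sub_eq_inv hm]
  have e1 : (-((m + 3 : ℕ) : ℤ) - 1) = -((m + 4 : ℕ) : ℤ) := by
    push_cast
    ring
  have e2 : (-((m + 3 : ℕ) : ℤ) + 1) = -((m + 2 : ℕ) : ℤ) := by
    push_cast
    ring
  have e3 : (-2 : ℤ) = -((2 : ℕ) : ℤ) := rfl
  rw [e1, e2, e3]
  simp only [inv_zpow', neg_neg, zpow_natCast, pow_add]
  generalize (1 + 1 / (m : ℝ)) ^ m = E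
  push_cast
  congr 1
  · field_simp
    ring
  · field_simp
    ring
end

section
/- Let k ≥ 2 be an integer and c a natural number. Then the limit as n → ∞ of C(n^k − k·n + c, n^(k−1)) / C(n^k, n^(k−1)) equals e^(−k). -/
open Filter

lemma cast_choose_div_choose_eq_prod (a B M : ℕ) (h : M < B) :
    ((B.choose M : ℝ) / ((B + a).choose M : ℝ)) =
      ∏ i ∈ Finset.range M, (((B : ℝ) - i) / ((B : ℝ) + a - i)) := by
  have hM : (M.factorial : ℝ) ≠ 0 := by exact_mod_cast M.factorial_ne_zero
  rw [← mul_div_mul_left _ _ hM, ← Nat.cast_mul, ← Nat.cast_mul,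
    ← Nat.descFactorial_eq_factorial_mul_choose, ← Nat.descFactorial_eq_factorial_mul_choose,
    Nat.descFactorial_eq_prod_range, Nat.descFactorial_eq_prod_range, Nat.cast_prod,
    Nat.cast_prod, ← Finset.prod_div_distrib]
  refine Finset.prod_congr rfl fun i hi => ?_
  have hi := Finset.mem_range.1 hi
  rw [Nat.cast_sub (by lia), Nat.cast_sub (by lia)]
  push_cast
  rfl

lemma choose_div_choose_le_exp (a B M : ℕ) (h : M < B) :
    ((B.choose M : ℝ) / ((B + a).choose M : ℝ)) ≤ Real.exp (-(a * M / ((B : ℝ) + a))) := by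
  have hexp : Real.exp (-(a * M / ((B : ℝ) + a))) =
      ∏ _i ∈ Finset.range M, Real.exp (-(a / ((B : ℝ) + a))) := by
    rw [Finset.prod_const, Finset.card_range, ← Real.exp_nat_mul]
    ring_nf
  rw [cast_choose_div_choose_eq_prod a B M h, hexp]
  have hB : (M : ℝ) < B := by exact_mod_cast h
  refine Finset.prod_le_prod (fun i hi => ?_) fun i hi => ?_ <;>
    have hi : (i : ℝ) < M := by exact_mod_cast Finset.mem_range.1 hi
  · have ha : (0 : ℝ) ≤ a := a.cast_nonneg
    exact div_nonneg (by linarith) (by linarith)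
  · have ha : (0 : ℝ) ≤ a := a.cast_nonneg
    have hi0 : (0 : ℝ) ≤ i := i.cast_nonneg
    calc ((B : ℝ) - i) / (B + a - i) = 1 - a / (B + a - i) := by
          rw [eq_sub_iff_add_eq, ← add_div, div_eq_one_iff_eq (by linarith)]
          ring
      _ ≤ 1 - a / (B + a) := by
          gcongr
          · linarith
          · linarith
      _ ≤ Real.exp (-(a / ((B : ℝ) + a))) := Real.one_sub_le_exp_neg _

lemma exp_le_choose_div_choose (a B M : ℕ) (h : M < B) :
    Real.exp (-(a * M / ((B : ℝ) - M))) ≤ ((B.choose M : ℝ) / ((B + a).choose M : ℝ)) := by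
  have hexp : Real.exp (-(a * M / ((B : ℝ) - M))) =
      ∏ _i ∈ Finset.range M, Real.exp (-(a / ((B : ℝ) - M))) := by
    rw [Finset.prod_const, Finset.card_range, ← Real.exp_nat_mul]
    ring_nf
  rw [cast_choose_div_choose_eq_prod a B M h, hexp]
  have hB : (M : ℝ) < B := by exact_mod_cast h
  refine Finset.prod_le_prod (fun i _ => (Real.exp_pos _).le) fun i hi => ?_
  have hi : (i : ℝ) < M := by exact_mod_cast Finset.mem_range.1 hi
  have ha : (0 : ℝ) ≤ a := a.cast_nonneg
  have hBi : (0 : ℝ) < B - i := by linarith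
  rw [Real.exp_neg, ← inv_div ((B : ℝ) + a - i)]
  have hpos : 0 < ((B : ℝ) + a - i) / (B - i) := div_pos (by linarith) hBi
  refine inv_anti₀ hpos ?_
  calc ((B : ℝ) + a - i) / (B - i) = a / (B - i) + 1 := by
        field_simp
        ring
    _ ≤ a / (B - M) + 1 := by
        gcongr
    _ ≤ Real.exp (a / (B - M)) := Real.add_one_le_exp _

/-- For an integer `k ≥ 2` and a natural number `c`, the limit as `n → ∞` of
`C(n^k - k·n + c, n^(k-1)) / C(n^k, n^(k-1))` equals `e^(-k)`. -/
theorem stmt14 (k : ℕ) (hk : 2 ≤ k) (c : ℕ) :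
    Tendsto (fun n : ℕ =>
      (((n ^ k - k * n + c).choose (n ^ (k - 1)) : ℝ) /
        ((n ^ k).choose (n ^ (k - 1)) : ℝ)))
      atTop (nhds (Real.exp (-(k : ℝ)))) := by
  have hinv : Tendsto (fun n : ℕ => (1 : ℝ) / n) atTop (nhds 0) :=
    tendsto_one_div_atTop_nhds_zero_nat
  have hpow : Tendsto (fun n : ℕ => (1 : ℝ) / (n : ℝ) ^ (k - 1)) atTop (nhds 0) := by
    simpa [Function.comp_def] using
      hinv.comp (tendsto_pow_atTop (α := ℕ) (n := k - 1) (by lia))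
  have hnum : Tendsto (fun n : ℕ => (k : ℝ) - c * (1 / n)) atTop (nhds k) := by
    simpa using (hinv.const_mul (c : ℝ)).const_sub (k : ℝ)
  have hlow : Tendsto (fun n : ℕ => ((k : ℝ) - c * (1 / n)) /
      (1 - (k - c * (1 / n)) * (1 / (n : ℝ) ^ (k - 1)) - 1 / n)) atTop (nhds k) := by
    simpa [Pi.div_def] using hnum.div (((hnum.mul hpow).const_sub 1).sub hinv) (by simp)
  have hbounds : ∀ᶠ n : ℕ in atTop, 0 < n ∧ c ≤ k * n ∧ k * n ≤ n ^ k ∧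
      n ^ (k - 1) < n ^ k - k * n + c := by
    filter_upwards [eventually_ge_atTop (k + 2), eventually_ge_atTop c] with n hn hc
    have hle : n ≤ n ^ (k - 1) := Nat.le_self_pow (by lia) n
    have hsucc : n ^ k = n ^ (k - 1) * n := by
      rw [← pow_succ]
      congr 1
      lia
    have hlt : k * n + n ^ (k - 1) < n ^ k := by
      rw [hsucc]
      nlinarith
    exact ⟨by lia, by nlinarith, by lia, by lia⟩
  refine tendsto_of_tendsto_of_tendsto_of_le_of_le'
    ((Real.continuous_exp.tendsto _).comp hlow.neg)
    ((Real.continuous_exp.tendsto _).comp hnum.neg) ?_ ?_ <;>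
  · filter_upwards [hbounds] with n ⟨hn, hc, hkn, hlt⟩
    have hn0 : (n : ℝ) ≠ 0 := by exact_mod_cast hn.ne'
    have hsum : n ^ k - k * n + c + (k * n - c) = n ^ k := by lia
    have hsucc : (n : ℝ) ^ k = (n : ℝ) ^ (k - 1) * n := by
      rw [← pow_succ]
      congr 1
      lia
    have hupper := choose_div_choose_le_exp (k * n - c) _ _ hlt
    have hlower := exp_le_choose_div_choose (k * n - c) _ _ hlt
    rw [hsum] at hupper hlower
    push_cast [Nat.cast_sub hc, Nat.cast_sub hkn] at hupper hlower
    have hscale : (n : ℝ) ^ (k - 1) * n ≠ 0 := by positivity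
    have hnumer : ((k : ℝ) * n - c) * n ^ (k - 1) =
        (k - c * (1 / n)) * ((n : ℝ) ^ (k - 1) * n) := by
      field_simp
    simp only [Function.comp_apply]
    first
    | refine le_trans (le_of_eq ?_) hlower
      have hdenom : (n : ℝ) ^ (k - 1) * n - k * n + c - n ^ (k - 1) =
          (1 - (k - c * (1 / n)) * (1 / (n : ℝ) ^ (k - 1)) - 1 / n) *
            ((n : ℝ) ^ (k - 1) * n) := by
        field_simp
        ring
      rw [hsucc, hnumer, hdenom, mul_div_mul_right _ _ hscale]
    | refine hupper.trans (le_of_eq ?_)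
      have hdenom : (n : ℝ) ^ (k - 1) * n - k * n + c + (k * n - c) = (n : ℝ) ^ (k - 1) * n := by
        ring
      rw [hsucc, hnumer, hdenom, mul_div_cancel_right₀ _ hscale]
end

section
/- Let k ≥ 2 be an integer and a a natural number. Then the limit as n → ∞ of C(n^k − k·n^(k−1) − a·n^(k−2), n) / C(n^k, n) equals e^(−k). -/
open Filter

theorem cast_choose_div_choose_eq_prod_s15 {M N n : ℕ} (hnM : n ≤ M) (hnN : n ≤ N) :
    (M.choose n : ℝ) / N.choose n = ∏ i ∈ Finset.range n, ((M : ℝ) - i) / ((N : ℝ) - i) := by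
  have key {L : ℕ} (hL : n ≤ L) :
      (n.factorial : ℝ) * L.choose n = ∏ i ∈ Finset.range n, ((L : ℝ) - i) := by
    rw [← Nat.cast_mul, ← Nat.descFactorial_eq_factorial_mul_choose,
      Nat.descFactorial_eq_prod_range, Nat.cast_prod]
    refine Finset.prod_congr rfl fun i hi => ?_
    rw [Nat.cast_sub ((Finset.mem_range.1 hi).le.trans hL)]
  rw [Finset.prod_div_distrib, ← key hnM, ← key hnN,
    mul_div_mul_left _ _ (Nat.cast_ne_zero.2 n.factorial_ne_zero)]

theorem sub_div_sub_le_sub_div_sub {x y s t : ℝ} (hxy : x ≤ y) (hst : s ≤ t) (hty : t < y) :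
    (x - t) / (y - t) ≤ (x - s) / (y - s) := by
  rw [div_le_div_iff₀ (by linarith) (by linarith)]
  nlinarith [mul_nonneg (sub_nonneg.2 hxy) (sub_nonneg.2 hst)]

theorem choose_div_choose_le_pow {M N n : ℕ} (hnM : n ≤ M) (hMN : M ≤ N) (hnN : n < N) :
    (M.choose n : ℝ) / N.choose n ≤ ((M : ℝ) / N) ^ n := by
  rw [cast_choose_div_choose_eq_prod_s15 hnM hnN.le]
  refine (Finset.prod_le_prod (g := fun _ => (M : ℝ) / N) (fun i hi => ?_)
    fun i hi => ?_).trans_eq (by simp [div_pow]) <;>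
    have hi := Finset.mem_range.1 hi
  · exact div_nonneg (sub_nonneg.2 (by exact_mod_cast hi.le.trans hnM))
      (sub_nonneg.2 (by exact_mod_cast hi.le.trans hnN.le))
  · simpa using sub_div_sub_le_sub_div_sub (x := M) (y := N) (s := 0) (t := i)
      (by exact_mod_cast hMN) (by positivity) (by exact_mod_cast hi.trans hnN)

theorem pow_le_choose_div_choose {M N n : ℕ} (hnM : n ≤ M) (hMN : M ≤ N) (hnN : n < N) :
    (((M : ℝ) - n) / ((N : ℝ) - n)) ^ n ≤ (M.choose n : ℝ) / N.choose n := by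
  rw [cast_choose_div_choose_eq_prod_s15 hnM hnN.le]
  refine Eq.trans_le (by simp [div_pow]) (Finset.prod_le_prod
    (f := fun _ => ((M : ℝ) - n) / ((N : ℝ) - n)) (fun i hi => ?_) fun i hi => ?_)
  · exact div_nonneg (sub_nonneg.2 (by exact_mod_cast hnM))
      (sub_nonneg.2 (by exact_mod_cast hnN.le))
  · exact sub_div_sub_le_sub_div_sub (by exact_mod_cast hMN)
      (by exact_mod_cast (Finset.mem_range.1 hi).le) (by exact_mod_cast hnN)

/-- If both `n * ((N n - M n) / N n)` and `n * ((N n - M n) / (N n - n))` tend to `c`, then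
`(M n).choose n / (N n).choose n` tends to `exp (-c)`. -/
theorem tendsto_choose_div_choose_exp_neg {M N : ℕ → ℕ} {c : ℝ}
    (hnM : ∀ᶠ n in atTop, n ≤ M n) (hMN : ∀ᶠ n in atTop, M n ≤ N n)
    (hnN : ∀ᶠ n in atTop, n < N n)
    (h : Tendsto (fun n : ℕ => (n : ℝ) * (((N n : ℝ) - M n) / N n)) atTop (nhds c))
    (h' : Tendsto (fun n : ℕ => (n : ℝ) * (((N n : ℝ) - M n) / ((N n : ℝ) - n)))
      atTop (nhds c)) :
    Tendsto (fun n : ℕ => ((M n).choose n : ℝ) / (N n).choose n) atTop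
      (nhds (Real.exp (-c))) := by
  have lower := Real.tendsto_one_add_pow_exp_of_tendsto
    (g := fun n : ℕ => -(((N n : ℝ) - M n) / ((N n : ℝ) - n))) (t := -c)
    (by simpa using h'.neg)
  have upper := Real.tendsto_one_add_pow_exp_of_tendsto
    (g := fun n : ℕ => -(((N n : ℝ) - M n) / N n)) (t := -c) (by simpa using h.neg)
  refine tendsto_of_tendsto_of_tendsto_of_le_of_le' lower upper ?_ ?_ <;>
    filter_upwards [hnM, hMN, hnN] with n h₁ h₂ h₃
  · have hpos : (0 : ℝ) < (N n : ℝ) - n := sub_pos.2 (by exact_mod_cast h₃)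
    refine Eq.trans_le ?_ (pow_le_choose_div_choose h₁ h₂ h₃)
    congr 1
    field_simp
    ring
  · have hpos : (0 : ℝ) < N n := by exact_mod_cast (Nat.zero_le n).trans_lt h₃
    refine (choose_div_choose_le_pow h₁ h₂ h₃).trans_eq ?_
    congr 1
    field_simp
    ring

/-- For an integer `k ≥ 2` and a natural number `a`, the limit as `n → ∞` of
`C(n^k - k·n^(k-1) - a·n^(k-2), n) / C(n^k, n)` equals `e^(-k)`. -/
theorem stmt15 (k : ℕ) (hk : 2 ≤ k) (a : ℕ) :
    Tendsto (fun n : ℕ =>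
      (((n ^ k - k * n ^ (k - 1) - a * n ^ (k - 2)).choose n : ℝ) /
        ((n ^ k).choose n : ℝ)))
      atTop (nhds (Real.exp (-(k : ℝ)))) := by
  obtain ⟨m, rfl⟩ := Nat.exists_eq_add_of_le' hk
  simp only [show m + 2 - 1 = m + 1 from rfl, Nat.add_sub_cancel]
  have large : ∀ᶠ n : ℕ in atTop,
      (m + 2) * n ^ (m + 1) + a * n ^ m + n ≤ n ^ (m + 2) := by
    filter_upwards [eventually_ge_atTop (m + 2 + a + 1)] with n hn
    have h₁ : n ^ m ≤ n ^ (m + 1) := Nat.pow_le_pow_right (by omega) (by omega)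
    have h₂ : n ≤ n ^ (m + 1) := Nat.le_self_pow (by omega) n
    calc (m + 2) * n ^ (m + 1) + a * n ^ m + n
        ≤ (m + 2) * n ^ (m + 1) + a * n ^ (m + 1) + n ^ (m + 1) := by gcongr
      _ = (m + 2 + a + 1) * n ^ (m + 1) := by ring
      _ ≤ n * n ^ (m + 1) := by gcongr
      _ = n ^ (m + 2) := by ring
  have gap : ∀ᶠ n : ℕ in atTop,
      ((n ^ (m + 2) : ℕ) : ℝ) -
        ((n ^ (m + 2) - (m + 2) * n ^ (m + 1) - a * n ^ m : ℕ) : ℝ) =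
        ((m + 2 : ℕ) : ℝ) * (n : ℝ) ^ (m + 1) + a * (n : ℝ) ^ m := by
    filter_upwards [large] with n hn
    rw [Nat.cast_sub (by omega), Nat.cast_sub (by omega)]
    push_cast
    ring
  have num : Tendsto (fun n : ℕ => ((m + 2 : ℕ) : ℝ) + a / (n : ℝ)) atTop
      (nhds ((m + 2 : ℕ) : ℝ)) := by
    simpa using (tendsto_const_div_atTop_nhds_zero_nat (a : ℝ)).const_add ((m + 2 : ℕ) : ℝ)
  have den : Tendsto (fun n : ℕ => 1 - ((n : ℝ)⁻¹) ^ (m + 1)) atTop (nhds 1) := by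
    simpa using (tendsto_inv_atTop_nhds_zero_nat (𝕜 := ℝ)).pow (m + 1) |>.const_sub 1
  refine tendsto_choose_div_choose_exp_neg (N := fun n => n ^ (m + 2)) ?_ ?_ ?_ ?_ ?_
  · filter_upwards [large] with n hn
    omega
  · exact Eventually.of_forall fun n => by omega
  · filter_upwards [eventually_gt_atTop 1] with n hn
    exact lt_self_pow₀ hn (by omega)
  · refine num.congr' ?_
    filter_upwards [gap, eventually_gt_atTop 0] with n hn hlt
    have hpos : (0 : ℝ) < n := by exact_mod_cast hlt
    rw [hn]
    push_cast
    field_simp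
    ring
  · have quot := num.div den one_ne_zero
    rw [div_one] at quot
    refine quot.congr' ?_
    filter_upwards [gap, eventually_gt_atTop 1] with n hn hlt
    have hone : (1 : ℝ) < n := by exact_mod_cast hlt
    have hpow : (n : ℝ) ^ (m + 1) - 1 ≠ 0 :=
      (sub_pos.2 (one_lt_pow₀ hone (by omega))).ne'
    have hne : (n : ℝ) ≠ 0 := by positivity
    have hden : 1 - ((n : ℝ)⁻¹) ^ (m + 1) = ((n : ℝ) ^ (m + 1) - 1) / (n : ℝ) ^ (m + 1) := by
      rw [inv_pow]
      field_simp
    have hsub : ((n ^ (m + 2) : ℕ) : ℝ) - n = n * ((n : ℝ) ^ (m + 1) - 1) := by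
      push_cast
      ring
    simp only [Pi.div_apply]
    rw [hn, hden, hsub]
    field_simp
    ring
end

section
/- Let c be a natural number. Then the limit as n → ∞ of C(n³ − 3n + c, ⌊n²/2⌋) / C(n³, ⌊n²/2⌋) equals e^(−3/2). -/
open Filter

theorem choose_le_choose_mul_pow {M N : ℕ} {r : ℝ} (hr : 0 ≤ r) (k : ℕ)
    (h : ∀ i < k, ((M - i : ℕ) : ℝ) ≤ (N - i : ℕ) * r) :
    (M.choose k : ℝ) ≤ N.choose k * r ^ k := by
  induction k with
  | zero => simp
  | succ k ih =>
    have ih' := ih fun i hi => h i (by omega)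
    have hk := h k (by omega)
    have hM : (M.choose (k + 1) : ℝ) * (k + 1) = M.choose k * (M - k : ℕ) := by
      exact_mod_cast Nat.choose_succ_right_eq M k
    have hN : (N.choose (k + 1) : ℝ) * (k + 1) = N.choose k * (N - k : ℕ) := by
      exact_mod_cast Nat.choose_succ_right_eq N k
    have hpos : (0 : ℝ) < k + 1 := by positivity
    refine le_of_mul_le_mul_right ?_ hpos
    calc (M.choose (k + 1) : ℝ) * (k + 1) = M.choose k * (M - k : ℕ) := hM
      _ ≤ (N.choose k * r ^ k) * ((N - k : ℕ) * r) := by gcongr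
      _ = (N.choose (k + 1) * (k + 1)) * r ^ (k + 1) := by rw [hN]; ring
      _ = _ := by ring

theorem choose_div_choose_le_exp_s16 {M N k : ℕ} (hMN : M ≤ N) (hk : k ≤ M) (hN : 0 < N) :
    (M.choose k : ℝ) / N.choose k ≤ Real.exp (-(k * ((N - M : ℝ) / N))) := by
  have hpos : (0 : ℝ) < N.choose k := by exact_mod_cast Nat.choose_pos (hk.trans hMN)
  have hN' : (0 : ℝ) < N := by exact_mod_cast hN
  have hMN' : (M : ℝ) ≤ N := by exact_mod_cast hMN
  rw [div_le_iff₀' hpos, ← mul_neg, Real.exp_nat_mul]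
  refine choose_le_choose_mul_pow (Real.exp_nonneg _) k fun i hi => ?_
  have hi' : (i : ℝ) ≤ N := by exact_mod_cast (by omega : i ≤ N)
  rw [Nat.cast_sub (by omega), Nat.cast_sub (by omega)]
  have hexp := Real.add_one_le_exp (-((N - M : ℝ) / N))
  calc (M - i : ℝ) ≤ (N - i) * (-((N - M : ℝ) / N) + 1) := by
        have : (N - i : ℝ) * (-((N - M : ℝ) / N) + 1) = M - i + i * (N - M) / N := by
          field_simp; ring
        rw [this]
        have : 0 ≤ (i : ℝ) * (N - M) / N :=
          div_nonneg (mul_nonneg i.cast_nonneg (sub_nonneg.2 hMN')) hN'.le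
        linarith
    _ ≤ _ := mul_le_mul_of_nonneg_left hexp (sub_nonneg.2 hi')

theorem exp_le_choose_div_choose_s16 {M N k : ℕ} (hMN : M ≤ N) (hk : k < M) :
    Real.exp (-(k * ((N - M : ℝ) / (M - k)))) ≤ (M.choose k : ℝ) / N.choose k := by
  have hpos : (0 : ℝ) < N.choose k := by exact_mod_cast Nat.choose_pos (hk.le.trans hMN)
  have hMN' : (M : ℝ) ≤ N := by exact_mod_cast hMN
  have hk' : (0 : ℝ) < M - k := sub_pos.2 (by exact_mod_cast hk)
  rw [le_div_iff₀ hpos, Real.exp_neg, inv_mul_le_iff₀ (Real.exp_pos _), mul_comm,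
    Real.exp_nat_mul]
  refine choose_le_choose_mul_pow (Real.exp_nonneg _) k fun i hi => ?_
  have hik : (i : ℝ) ≤ k := by exact_mod_cast hi.le
  rw [Nat.cast_sub (by omega), Nat.cast_sub (by omega)]
  have hexp := Real.add_one_le_exp ((N - M : ℝ) / (M - k))
  calc (N - i : ℝ) ≤ (M - i) * ((N - M : ℝ) / (M - k) + 1) := by
        have : (M - i : ℝ) * ((N - M : ℝ) / (M - k) + 1)
            = N - i + (k - i) * (N - M) / (M - k) := by
          field_simp; ring
        rw [this]
        have : 0 ≤ (k - i : ℝ) * (N - M) / (M - k) :=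
          div_nonneg (mul_nonneg (sub_nonneg.2 hik) (sub_nonneg.2 hMN')) hk'.le
        linarith
    _ ≤ _ := mul_le_mul_of_nonneg_left hexp (by linarith)

theorem tendsto_sq_div_two_div_sq :
    Tendsto (fun n : ℕ => ((n ^ 2 / 2 : ℕ) : ℝ) / (n : ℝ) ^ 2) atTop (nhds (1 / 2)) := by
  have h := (tendsto_nat_floor_mul_div_atTop (R := ℝ) (a := 1 / 2) (by norm_num)).comp
    ((tendsto_pow_atTop (two_ne_zero)).comp (tendsto_natCast_atTop_atTop (R := ℝ)))
  refine h.congr fun n => ?_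
  have : ⌊(1 / 2 : ℝ) * (n : ℝ) ^ 2⌋₊ = n ^ 2 / 2 := by
    rw [← Nat.floor_div_eq_div (K := ℝ)]
    push_cast
    ring_nf
  simp only [Function.comp_apply, this]

/-- For a natural number `c`, the limit as `n → ∞` of
`C(n³ - 3n + c, ⌊n²/2⌋) / C(n³, ⌊n²/2⌋)` equals `e^(-3/2)`. -/
theorem stmt16 (c : ℕ) :
    Tendsto (fun n : ℕ =>
      (((n ^ 3 - 3 * n + c).choose (n ^ 2 / 2) : ℝ) /
        ((n ^ 3).choose (n ^ 2 / 2) : ℝ)))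
      atTop (nhds (Real.exp (-(3 / 2 : ℝ)))) := by
  have hinv : Tendsto (fun n : ℕ => (n : ℝ)⁻¹) atTop (nhds 0) :=
    tendsto_inv_atTop_nhds_zero_nat
  have hd : Tendsto (fun n : ℕ => 3 - c * (n : ℝ)⁻¹) atTop (nhds 3) := by
    simpa using (hinv.const_mul (c : ℝ)).const_sub 3
  have hk := tendsto_sq_div_two_div_sq
  have hden : Tendsto (fun n : ℕ => 1 - (3 - c * (n : ℝ)⁻¹) * (n : ℝ)⁻¹ ^ 2
      - ((n ^ 2 / 2 : ℕ) : ℝ) / (n : ℝ) ^ 2 * (n : ℝ)⁻¹) atTop (nhds 1) := by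
    simpa using ((hd.mul (hinv.pow 2)).const_sub 1).sub (hk.mul hinv)
  have hupper : Tendsto (fun n : ℕ => Real.exp (-(((n ^ 2 / 2 : ℕ) : ℝ) / (n : ℝ) ^ 2 *
      (3 - c * (n : ℝ)⁻¹)))) atTop (nhds (Real.exp (-(3 / 2 : ℝ)))) := by
    refine (Real.continuous_exp.tendsto _).comp ?_
    convert (hk.mul hd).neg using 2
    norm_num
  have hlower : Tendsto (fun n : ℕ => Real.exp (-(((n ^ 2 / 2 : ℕ) : ℝ) / (n : ℝ) ^ 2 *
      (3 - c * (n : ℝ)⁻¹) / (1 - (3 - c * (n : ℝ)⁻¹) * (n : ℝ)⁻¹ ^ 2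
      - ((n ^ 2 / 2 : ℕ) : ℝ) / (n : ℝ) ^ 2 * (n : ℝ)⁻¹)))) atTop
      (nhds (Real.exp (-(3 / 2 : ℝ)))) := by
    refine (Real.continuous_exp.tendsto _).comp ?_
    have h := ((hk.mul hd).div hden one_ne_zero).neg
    rwa [show -(1 / 2 * 3 / 1 : ℝ) = -(3 / 2) by norm_num] at h
  refine tendsto_of_tendsto_of_tendsto_of_le_of_le' hlower hupper ?_ ?_ <;>
    filter_upwards [eventually_ge_atTop (c + 3)] with n hn <;>
    have h3 : 3 * n ≤ n ^ 3 := by nlinarith [Nat.mul_le_mul hn hn]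
  all_goals
    have hlt : n ^ 2 / 2 < n ^ 3 - 3 * n + c := by
      have : n ^ 2 + 6 * n < 2 * n ^ 3 := by nlinarith [Nat.mul_le_mul hn hn]
      omega
    have hle : n ^ 3 - 3 * n + c ≤ n ^ 3 := by omega
    have hn0 : (n : ℝ) ≠ 0 := by exact_mod_cast (by omega : n ≠ 0)
    have hcast : ((n ^ 3 - 3 * n + c : ℕ) : ℝ) = n ^ 3 - 3 * n + c := by
      rw [Nat.cast_add, Nat.cast_sub h3]; push_cast; ring
  · refine le_of_eq_of_le ?_ (exp_le_choose_div_choose_s16 hle hlt)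
    rw [hcast, Nat.cast_pow]
    generalize ((n ^ 2 / 2 : ℕ) : ℝ) = k
    have hnum : k / (n : ℝ) ^ 2 * (3 - c * (n : ℝ)⁻¹)
        = k * ((n : ℝ) ^ 3 - (n ^ 3 - 3 * n + c)) / (n : ℝ) ^ 3 := by field_simp; ring
    have hden : 1 - (3 - c * (n : ℝ)⁻¹) * (n : ℝ)⁻¹ ^ 2 - k / (n : ℝ) ^ 2 * (n : ℝ)⁻¹
        = ((n : ℝ) ^ 3 - 3 * n + c - k) / (n : ℝ) ^ 3 := by field_simp; ring
    rw [hnum, hden, div_div_div_cancel_right₀ (pow_ne_zero 3 hn0), mul_div_assoc]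
  · refine (choose_div_choose_le_exp_s16 hle hlt.le (by omega)).trans_eq ?_
    rw [hcast, Nat.cast_pow]
    congr 2
    field_simp
    ring
end

section
/- The limit as n → ∞ of C(n³ − 3n² + 6n − 4, n) / C(n³, n) equals e^(−3), and the limit as n → ∞ of C(n³ − (3(n² − n)/2 + 1), n) / C(n³, n) equals e^(−3/2). -/
open Filter

/-- If `m n = n ^ 3 + t n ^ 2 + o(n ^ 2)`, then `C(m n, n) / C(n ^ 3, n)` tends to `exp t`. -/
lemma tendsto_choose_div_choose_cube {m : ℕ → ℕ} {t : ℝ} (hm : ∀ᶠ n in atTop, n ≤ m n)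
    (h : Tendsto (fun n : ℕ => ((m n : ℝ) - (n : ℝ) ^ 3) / (n : ℝ) ^ 2) atTop (nhds t)) :
    Tendsto (fun n : ℕ => ((m n).choose n : ℝ) / ((n ^ 3).choose n : ℝ)) atTop
      (nhds (Real.exp t)) := by
  have hinv : Tendsto (fun n : ℕ => (n : ℝ)⁻¹) atTop (nhds 0) := tendsto_inv_atTop_nhds_zero_nat
  have hsmall : Tendsto (fun n : ℕ => (n : ℝ)⁻¹ - (n : ℝ)⁻¹ ^ 2) atTop (nhds 0) := by
    simpa using hinv.sub (hinv.pow 2)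
  have hquot : Tendsto (fun n : ℕ => (1 + (n : ℝ)⁻¹ ^ 3 - (n : ℝ)⁻¹ ^ 2)⁻¹) atTop (nhds 1) := by
    have := ((hinv.pow 3).const_add 1).sub (hinv.pow 2)
    simpa using this.inv₀ (by norm_num)
  have hden : ∀ n : ℕ, 1 ≤ n → (0 : ℝ) < (n : ℝ) ^ 3 + 1 - n := by
    intro n hn
    have : (1 : ℝ) ≤ n := by exact_mod_cast hn
    have := le_self_pow₀ this (n := 3) (by norm_num)
    linarith
  have hlower : Tendsto (fun n : ℕ => (1 + ((m n : ℝ) + 1 - n - (n : ℝ) ^ 3) / (n : ℝ) ^ 3) ^ n)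
      atTop (nhds (Real.exp t)) := by
    apply Real.tendsto_one_add_pow_exp_of_tendsto
    have h' := h.sub hsmall
    rw [sub_zero] at h'
    refine h'.congr' ?_
    filter_upwards [eventually_ge_atTop 1] with n hn
    have : (n : ℝ) ≠ 0 := by positivity
    field_simp
    ring
  have hupper : Tendsto (fun n : ℕ =>
      (1 + ((m n : ℝ) - ((n : ℝ) ^ 3 + 1 - n)) / ((n : ℝ) ^ 3 + 1 - n)) ^ n)
      atTop (nhds (Real.exp t)) := by
    apply Real.tendsto_one_add_pow_exp_of_tendsto
    have h' := (h.add hsmall).mul hquot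
    rw [add_zero, mul_one] at h'
    refine h'.congr' ?_
    filter_upwards [eventually_ge_atTop 1] with n hn
    have h0 : (n : ℝ) ≠ 0 := by positivity
    have hd := (hden n hn).ne'
    have e : 1 + (n : ℝ)⁻¹ ^ 3 - (n : ℝ)⁻¹ ^ 2 = ((n : ℝ) ^ 3 + 1 - n) / (n : ℝ) ^ 3 := by
      field_simp
    rw [e, inv_div]
    field_simp
    ring
  have hratio : ∀ n : ℕ, ((m n).choose n : ℝ) / ((n ^ 3).choose n : ℝ) =
      ((m n).descFactorial n : ℝ) / ((n ^ 3).descFactorial n : ℝ) := by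
    intro n
    rw [Nat.descFactorial_eq_factorial_mul_choose, Nat.descFactorial_eq_factorial_mul_choose]
    push_cast
    rw [mul_div_mul_left _ _ (by exact_mod_cast n.factorial_ne_zero)]
  refine tendsto_of_tendsto_of_tendsto_of_le_of_le' hlower hupper ?_ ?_
  · filter_upwards [eventually_ge_atTop 1, hm] with n hn hmn
    have h0 : (n : ℝ) ^ 3 ≠ 0 := by positivity
    have hN : n ≤ n ^ 3 := Nat.le_self_pow (by norm_num) n
    have hpos : (0 : ℝ) < ((n ^ 3).descFactorial n : ℝ) := by
      exact_mod_cast Nat.descFactorial_pos.2 hN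
    have h1 : ((m n : ℝ) + 1 - n) ^ n ≤ ((m n).descFactorial n : ℝ) := by
      have := Nat.pow_sub_le_descFactorial (m n) n
      rw [← Nat.cast_le (α := ℝ)] at this
      rwa [Nat.cast_pow, Nat.cast_sub (by omega), Nat.cast_add_one] at this
    have h2 : ((n ^ 3).descFactorial n : ℝ) ≤ ((n : ℝ) ^ 3) ^ n := by
      exact_mod_cast Nat.descFactorial_le_pow (n ^ 3) n
    have e : 1 + ((m n : ℝ) + 1 - n - (n : ℝ) ^ 3) / (n : ℝ) ^ 3 =
        ((m n : ℝ) + 1 - n) / (n : ℝ) ^ 3 := by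
      field_simp
      ring
    rw [hratio, e, div_pow]
    exact div_le_div₀ (Nat.cast_nonneg _) h1 hpos h2
  · filter_upwards [eventually_ge_atTop 1] with n hn
    have hd := hden n hn
    have hN : n ≤ n ^ 3 := Nat.le_self_pow (by norm_num) n
    have h1 : ((n : ℝ) ^ 3 + 1 - n) ^ n ≤ ((n ^ 3).descFactorial n : ℝ) := by
      have := Nat.pow_sub_le_descFactorial (n ^ 3) n
      rw [← Nat.cast_le (α := ℝ)] at this
      rwa [Nat.cast_pow, Nat.cast_sub (by omega), Nat.cast_add_one, Nat.cast_pow] at this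
    have h2 : ((m n).descFactorial n : ℝ) ≤ (m n : ℝ) ^ n := by
      exact_mod_cast Nat.descFactorial_le_pow (m n) n
    have e : 1 + ((m n : ℝ) - ((n : ℝ) ^ 3 + 1 - n)) / ((n : ℝ) ^ 3 + 1 - n) =
        (m n : ℝ) / ((n : ℝ) ^ 3 + 1 - n) := by
      rw [sub_div, div_self hd.ne']
      ring
    rw [hratio, e, div_pow]
    exact div_le_div₀ (by positivity) h2 (by positivity) h1

/-- If `m n = n ^ 3 + a n ^ 2 + b n + c` for large `n`, then `C(m n, n) / C(n ^ 3, n)` tends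
to `exp a`. -/
lemma tendsto_choose_div_choose_cube_of_eq {m : ℕ → ℕ} {a b c : ℝ}
    (hle : ∀ᶠ n in atTop, n ≤ m n)
    (hm : ∀ᶠ n : ℕ in atTop, (m n : ℝ) = (n : ℝ) ^ 3 + a * (n : ℝ) ^ 2 + b * n + c) :
    Tendsto (fun n : ℕ => ((m n).choose n : ℝ) / ((n ^ 3).choose n : ℝ)) atTop
      (nhds (Real.exp a)) := by
  apply tendsto_choose_div_choose_cube hle
  have hinv : Tendsto (fun n : ℕ => (n : ℝ)⁻¹) atTop (nhds 0) := tendsto_inv_atTop_nhds_zero_nat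
  have h' := ((hinv.const_mul b).const_add a).add ((hinv.pow 2).const_mul c)
  have e : a + b * 0 + c * 0 ^ 2 = a := by ring
  rw [e] at h'
  refine h'.congr' ?_
  filter_upwards [eventually_ge_atTop 1, hm] with n hn hmn
  have : (n : ℝ) ≠ 0 := by positivity
  rw [hmn]
  field_simp
  ring

/-- The limit as `n → ∞` of `C(n³ - 3n² + 6n - 4, n) / C(n³, n)` equals `e^(-3)`
(all hyper-bishops maximally powerful), and the limit as `n → ∞` of
`C(n³ - (3(n² - n)/2 + 1), n) / C(n³, n)` equals `e^(-3/2)` (all hyper-bishops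
minimally powerful). -/
theorem stmt19 :
    Tendsto (fun n : ℕ =>
        (((n ^ 3 - 3 * n ^ 2 + 6 * n - 4).choose n : ℝ) / ((n ^ 3).choose n : ℝ)))
      atTop (nhds (Real.exp (-(3 : ℝ)))) ∧
    Tendsto (fun n : ℕ =>
        (((n ^ 3 - (3 * (n ^ 2 - n) / 2 + 1)).choose n : ℝ) / ((n ^ 3).choose n : ℝ)))
      atTop (nhds (Real.exp (-(3 / 2 : ℝ)))) := by
  constructor
  · have hval : ∀ n : ℕ, 4 ≤ n →
        n ^ 3 - 3 * n ^ 2 + 6 * n - 4 + 4 + 3 * n ^ 2 = n ^ 3 + 6 * n := by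
      intro n hn
      have : 3 * n ^ 2 ≤ n ^ 3 := by nlinarith [sq_nonneg n]
      omega
    apply tendsto_choose_div_choose_cube_of_eq (b := 6) (c := -4)
    · filter_upwards [eventually_ge_atTop 4] with n hn
      omega
    · filter_upwards [eventually_ge_atTop 4] with n hn
      have := congrArg (Nat.cast (R := ℝ)) (hval n hn)
      push_cast at this
      linarith
  · have hval : ∀ n : ℕ, 4 ≤ n →
        2 * (n ^ 3 - (3 * (n ^ 2 - n) / 2 + 1)) + 3 * n ^ 2 + 2 = 2 * n ^ 3 + 3 * n := by
      intro n hn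
      have h1 : 4 * n ^ 2 ≤ n ^ 3 := by nlinarith [sq_nonneg n]
      have h2 : 4 * n ≤ n ^ 2 := by nlinarith
      have h3 : 2 ∣ n ^ 2 - n := by
        rw [pow_two, ← Nat.mul_sub_one]
        exact (Nat.even_mul_pred_self n).two_dvd
      omega
    apply tendsto_choose_div_choose_cube_of_eq (b := 3 / 2) (c := -1)
    · filter_upwards [eventually_ge_atTop 4] with n hn
      have h1 : 4 * n ^ 2 ≤ n ^ 3 := by nlinarith [sq_nonneg n]
      have h2 : 4 * n ≤ n ^ 2 := by nlinarith
      have := hval n hn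
      omega
    · filter_upwards [eventually_ge_atTop 4] with n hn
      have := congrArg (Nat.cast (R := ℝ)) (hval n hn)
      simp only [Nat.cast_add, Nat.cast_mul, Nat.cast_pow, Nat.cast_ofNat] at this
      linarith
end
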